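/- For any |C|-dimensional teleportation protocol (ρ_{AB}, {Π^i}_{i=1}^N, {D^i}_{i=1}^N) with teleportation channel Λ, the entanglement fidelity satisfies F(Λ) ≤ |A|/|C|. -/

import Mathlib

open Matrix BigOperators Finset
open scoped Kronecker ComplexOrder

noncomputable section

/-- Partial trace over the second tensor factor. -/
def ptraceB {α β : Type*} [Fintype β] (M : Matrix (α × β) (α × β) ℂ) :
    Matrix α α ℂ :=
  Matrix.of fun a a' => ∑ b, M (a, b) (a', b)

/-- `ρ ↦ ∑ k (I ⊗ K k) ρ (I ⊗ K k)†`: a Kraus-operator channel `B → C` applied to the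
second factor of a bipartite matrix on `A ⊗ B`. -/
def idKrausApply {a b c : ℕ} {m : ℕ} (K : Fin m → Matrix (Fin c) (Fin b) ℂ)
    (ρ : Matrix (Fin a × Fin b) (Fin a × Fin b) ℂ) :
    Matrix (Fin a × Fin c) (Fin a × Fin c) ℂ :=
  ∑ k, ((1 : Matrix (Fin a) (Fin a) ℂ) ⊗ₖ K k) * ρ *
      ((1 : Matrix (Fin a) (Fin a) ℂ) ⊗ₖ K k)ᴴ

/-- The teleportation channel `Λ(σ) = ∑ i tr_{AC'}[(Πᵢ ⊗ I_C)(σ ⊗ ωᵢ)]`, written entrywise. -/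
def teleChannel {a c N : ℕ}
    (Pv ω : Fin N → Matrix (Fin a × Fin c) (Fin a × Fin c) ℂ)
    (σ : Matrix (Fin c) (Fin c) ℂ) : Matrix (Fin c) (Fin c) ℂ :=
  Matrix.of fun x y =>
    ∑ i, ∑ a₁ : Fin a, ∑ x₁ : Fin c, ∑ a₂ : Fin a, ∑ x₂ : Fin c,
      Pv i (a₁, x₁) (a₂, x₂) * σ x₂ x₁ * ω i (a₂, x) (a₁, y)

/-- The maximally entangled state `|Φ⁺⟩⟨Φ⁺|` with `|Φ⁺⟩ = c^{-1/2} ∑ᵢ |i⟩|i⟩`. -/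
def maxEnt (c : ℕ) : Matrix (Fin c × Fin c) (Fin c × Fin c) ℂ :=
  Matrix.of fun p q => if p.1 = p.2 ∧ q.1 = q.2 then (1 : ℂ) / c else 0

/-- `(id ⊗ Λ)(M)`, written entrywise (this is the correct formula for linear `Λ`). -/
def idOnFirst {c d : ℕ} (Λ : Matrix (Fin c) (Fin c) ℂ → Matrix (Fin c) (Fin c) ℂ)
    (M : Matrix (Fin d × Fin c) (Fin d × Fin c) ℂ) :
    Matrix (Fin d × Fin c) (Fin d × Fin c) ℂ :=
  Matrix.of fun p q => Λ (Matrix.of fun x y => M (p.1, x) (q.1, y)) p.2 q.2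

/-- Entanglement fidelity `F(Λ) = tr[Φ⁺ (id ⊗ Λ)(Φ⁺)]` of the teleportation channel
determined by the POVM `Pv` and the encoded states `ω`. -/
def entFid {a c N : ℕ}
    (Pv ω : Fin N → Matrix (Fin a × Fin c) (Fin a × Fin c) ℂ) : ℂ :=
  Matrix.trace (maxEnt c * idOnFirst (teleChannel Pv ω) (maxEnt c))

/-- Mutual information (base 2) of a joint probability distribution on a product of
finite sets; terms with `p x y = 0` vanish since `0 * log = 0`. -/
def mutInfo {X Y : Type*} [Fintype X] [Fintype Y] (p : X → Y → ℝ) : ℝ :=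
  ∑ x, ∑ y, p x y * Real.logb 2 (p x y / ((∑ y', p x y') * (∑ x', p x' y)))

/-- Binary entropy (base 2). -/
def binEnt (p : ℝ) : ℝ := -(p * Real.logb 2 p) - (1 - p) * Real.logb 2 (1 - p)

/-- The swap operator on `ℂ^d ⊗ ℂ^d`. -/
def swapOp (d : ℕ) : Matrix (Fin d × Fin d) (Fin d × Fin d) ℂ :=
  Matrix.of fun p q => if p.1 = q.2 ∧ p.2 = q.1 then 1 else 0

open scoped Matrix.Norms.Frobenius in
/-- The Frobenius norm squared is the trace of the Gram matrix. -/
theorem trace_conjTranspose_mul_self_eq_frobenius_sq {m n : Type*} [Fintype m] [Fintype n]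
    (X : Matrix m n ℂ) : (Xᴴ * X).trace = ((‖X‖ ^ 2 : ℝ) : ℂ) := by
  have h : ‖X‖ ^ 2 = ∑ i, ∑ j, ‖X i j‖ ^ 2 := by
    rw [Matrix.frobenius_norm_def, ← Real.sqrt_eq_rpow, Real.sq_sqrt (by positivity)]
    simp
  rw [h, Finset.sum_comm]
  simp [Matrix.trace, Matrix.mul_apply, ← Complex.conj_mul']

open scoped MatrixOrder Matrix.Norms.L2Operator in
/-- A positive semidefinite matrix is the Gram matrix of a square matrix. -/
theorem exists_eq_conjTranspose_mul_self {n : Type*} [Fintype n] [DecidableEq n]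
    {P : Matrix n n ℂ} (hP : P.PosSemidef) : ∃ X : Matrix n n ℂ, P = Xᴴ * X :=
  CStarAlgebra.nonneg_iff_eq_star_mul_self.mp hP.nonneg

open scoped Matrix.Norms.Frobenius in
/-- For positive semidefinite matrices, the trace of a product is at most the product of the
traces. -/
theorem trace_mul_le_trace_mul_trace {n : Type*} [Fintype n] [DecidableEq n]
    {P Q : Matrix n n ℂ} (hP : P.PosSemidef) (hQ : Q.PosSemidef) :
    (P * Q).trace ≤ P.trace * Q.trace := by
  obtain ⟨X, rfl⟩ := exists_eq_conjTranspose_mul_self hP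
  obtain ⟨Y, rfl⟩ := exists_eq_conjTranspose_mul_self hQ
  have h : (Xᴴ * X * (Yᴴ * Y)).trace = ((X * Yᴴ)ᴴ * (X * Yᴴ)).trace := by
    rw [Matrix.conjTranspose_mul, Matrix.conjTranspose_conjTranspose, Matrix.mul_assoc Y,
      Matrix.trace_mul_comm Y]
    simp only [Matrix.mul_assoc]
  rw [h]
  simp only [trace_conjTranspose_mul_self_eq_frobenius_sq]
  rw [← Complex.ofReal_mul, Complex.real_le_real, ← mul_pow]
  gcongr
  calc ‖X * Yᴴ‖ ≤ ‖X‖ * ‖Yᴴ‖ := Matrix.frobenius_norm_mul _ _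
    _ = ‖X‖ * ‖Y‖ := by rw [Matrix.frobenius_norm_conjTranspose]

theorem posSemidef_idKrausApply {a b c m : ℕ} (K : Fin m → Matrix (Fin c) (Fin b) ℂ)
    {ρ : Matrix (Fin a × Fin b) (Fin a × Fin b) ℂ} (hρ : ρ.PosSemidef) :
    (idKrausApply K ρ).PosSemidef :=
  Matrix.posSemidef_sum _ fun _ _ => hρ.mul_mul_conjTranspose_same _

theorem trace_idKrausApply {a b c m : ℕ} {K : Fin m → Matrix (Fin c) (Fin b) ℂ}
    (hK : ∑ k, (K k)ᴴ * K k = 1) (ρ : Matrix (Fin a × Fin b) (Fin a × Fin b) ℂ) :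
    (idKrausApply K ρ).trace = ρ.trace := by
  have h : ∑ k, ((1 : Matrix (Fin a) (Fin a) ℂ) ⊗ₖ K k)ᴴ *
      ((1 : Matrix (Fin a) (Fin a) ℂ) ⊗ₖ K k) = 1 := by
    simp only [Matrix.conjTranspose_kronecker, ← Matrix.mul_kronecker_mul,
      Matrix.conjTranspose_one, Matrix.one_mul]
    rw [← Matrix.one_kronecker_one, ← hK]
    ext i j
    simp [Matrix.kroneckerMap_apply, Matrix.sum_apply, Finset.mul_sum]
  calc (idKrausApply K ρ).trace
      = ((∑ k, ((1 : Matrix (Fin a) (Fin a) ℂ) ⊗ₖ K k)ᴴ *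
          ((1 : Matrix (Fin a) (Fin a) ℂ) ⊗ₖ K k)) * ρ).trace := by
        rw [idKrausApply, Matrix.trace_sum, Matrix.sum_mul, Matrix.trace_sum]
        exact Finset.sum_congr rfl fun k _ => Matrix.trace_mul_cycle _ _ _
    _ = ρ.trace := by rw [h, Matrix.one_mul]

/-- The entanglement fidelity of a teleportation channel is `|C|⁻² ∑ i tr(Πᵢ ωᵢ)`. -/
theorem entFid_eq_sum_trace {a c N : ℕ}
    (Pv ω : Fin N → Matrix (Fin a × Fin c) (Fin a × Fin c) ℂ) :
    entFid Pv ω = (∑ i, (Pv i * ω i).trace) / (c : ℂ) ^ 2 := by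
  have hM : ∀ j x k y : Fin c, maxEnt c (j, x) (k, y)
      = (if j = x then 1 else 0) * (if k = y then 1 else 0) * (1 / (c : ℂ)) := by
    intro j x k y
    by_cases h₁ : j = x <;> by_cases h₂ : k = y <;> simp [maxEnt, h₁, h₂]
  have h : entFid Pv ω = ∑ j : Fin c, ∑ k : Fin c, ∑ i, ∑ a₁ : Fin a, ∑ a₂ : Fin a,
      Pv i (a₁, j) (a₂, k) * ω i (a₂, k) (a₁, j) / (c : ℂ) ^ 2 := by
    simp only [entFid, Matrix.trace, Matrix.diag, Matrix.mul_apply, Fintype.sum_prod_type,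
      idOnFirst, teleChannel, Matrix.of_apply, hM]
    simp [Finset.mul_sum, div_eq_mul_inv]
    refine Finset.sum_congr rfl fun j _ => Finset.sum_congr rfl fun k _ =>
      Finset.sum_congr rfl fun i _ => Finset.sum_congr rfl fun a₁ _ =>
      Finset.sum_congr rfl fun a₂ _ => ?_
    ring
  rw [h]
  simp only [Matrix.trace, Matrix.diag, Matrix.mul_apply, Fintype.sum_prod_type, Finset.sum_div]
  calc _ = ∑ j : Fin c, ∑ i, ∑ k : Fin c, ∑ a₁ : Fin a, ∑ a₂ : Fin a,
      Pv i (a₁, j) (a₂, k) * ω i (a₂, k) (a₁, j) / (c : ℂ) ^ 2 :=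
        Finset.sum_congr rfl fun j _ => Finset.sum_comm
    _ = ∑ i, ∑ j : Fin c, ∑ k : Fin c, ∑ a₁ : Fin a, ∑ a₂ : Fin a,
      Pv i (a₁, j) (a₂, k) * ω i (a₂, k) (a₁, j) / (c : ℂ) ^ 2 := Finset.sum_comm
    _ = _ := by
        refine Finset.sum_congr rfl fun i _ => ?_
        rw [Finset.sum_comm (s := (univ : Finset (Fin a)))]
        refine Finset.sum_congr rfl fun j _ => ?_
        rw [Finset.sum_comm]
        exact Finset.sum_congr rfl fun a₁ _ => Finset.sum_comm

/-- the entanglement fidelity of any teleportation protocol is at most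
`|A|/|C|`. -/
theorem stmt_1 {a b c N m : ℕ} (hc : 0 < c)
    (ρ : Matrix (Fin a × Fin b) (Fin a × Fin b) ℂ)
    (hρ : ρ.PosSemidef) (hρtr : ρ.trace = 1)
    (Pv : Fin N → Matrix (Fin a × Fin c) (Fin a × Fin c) ℂ)
    (hPv : ∀ i, (Pv i).PosSemidef) (hPvsum : ∑ i, Pv i = 1)
    (K : Fin N → Fin m → Matrix (Fin c) (Fin b) ℂ)
    (hK : ∀ i, ∑ k, (K i k)ᴴ * K i k = 1) :
    entFid Pv (fun i => idKrausApply (K i) ρ) ≤ (a : ℂ) / (c : ℂ) := by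
  rw [entFid_eq_sum_trace]
  have hc' : (c : ℂ) ≠ 0 := by exact_mod_cast hc.ne'
  have h : ∑ i, (Pv i * idKrausApply (K i) ρ).trace ≤ (a : ℂ) * c := by
    calc ∑ i, (Pv i * idKrausApply (K i) ρ).trace ≤ ∑ i, (Pv i).trace := by
          refine Finset.sum_le_sum fun i _ => ?_
          simpa [trace_idKrausApply (hK i), hρtr] using
            trace_mul_le_trace_mul_trace (hPv i) (posSemidef_idKrausApply (K i) hρ)
      _ = (a : ℂ) * c := by
          rw [← Matrix.trace_sum, hPvsum]
          simp
  calc (∑ i, (Pv i * idKrausApply (K i) ρ).trace) / (c : ℂ) ^ 2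
      = (∑ i, (Pv i * idKrausApply (K i) ρ).trace) * (((c : ℝ) ^ 2)⁻¹ : ℝ) := by
        push_cast; rw [div_eq_mul_inv]
    _ ≤ (a : ℂ) * c * (((c : ℝ) ^ 2)⁻¹ : ℝ) :=
        mul_le_mul_of_nonneg_right h (Complex.zero_le_real.mpr (by positivity))
    _ = (a : ℂ) / c := by push_cast; field_simp
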